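/- arXiv:2205.11979 — 5 statements merged into one kernel-verified Lean document; each statement's English description precedes it below -/
import Mathlib

section
/- Suppose the hyperparameter θ equals 1/2, the dual variables are initialized as z_{i|j}^{(0)} = A_{i|j} x_j^{(0)}, and α_{i|j} = α_{j|i} ≥ 0 for all edges (i,j) ∈ E. Then for every choice of the vectors g_i^{(r)} ∈ ℝ^d, the sequences (x_i^{(r)}) produced by the ECL updates x_i^{(r+1)} = (1 + η Σ_{j∈N_i} α_{i|j})^{-1} (x_i^{(r)} − η g_i^{(r)} + η Σ_{j∈N_i} α_{i|j} A_{i|j} z_{i|j}^{(r)}), y_{i|j}^{(r+1)} = z_{i|j}^{(r)} − 2 A_{i|j} x_i^{(r+1)}, z_{i|j}^{(r+1)} = (1/2) z_{i|j}^{(r)} + (1/2) y_{j|i}^{(r+1)} coincide, from the same initialization x_i^{(0)}, with the sequences produced by x_i^{(r+1)} = Σ_{j∈N_i⁺} W_{ij} x_j^{(r)} − η′_i (g_i^{(r)} − c_i^{(r)}) and c_i^{(r+1)} = c_i^{(r)} + (1/2) Σ_{j∈N_i} α_{i|j} (x_j^{(r+1)} − x_i^{(r+1)}), where c_i^{(0)}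 = (1/2) Σ_{j∈N_i} α_{i|j} (x_j^{(0)} − x_i^{(0)}). -/
open Finset

/-- The mixing step over the closed neighborhood `insert i s`, with the ECL weights, expressed
through the pairwise sums `v i + v j`. -/
lemma sum_insert_mixing_weights {ι E : Type*} [DecidableEq ι] [AddCommGroup E] [Module ℝ E]
    {s : Finset ι} {i : ι} (hi : i ∉ s) {η : ℝ} {a : ι → ℝ} (hpos : 0 < 1 + η * ∑ j ∈ s, a j)
    {w : ι → ℝ} (hwi : w i = (2 + η * ∑ j ∈ s, a j) / (2 * (1 + η * ∑ j ∈ s, a j)))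
    (hw : ∀ j ∈ s, w j = η * a j / (2 * (1 + η * ∑ j ∈ s, a j))) (v : ι → E) :
    ∑ j ∈ insert i s, w j • v j =
      (1 + η * ∑ j ∈ s, a j)⁻¹ • (v i + (η / 2) • ∑ j ∈ s, a j • (v i + v j)) := by
  have hsum : ∑ j ∈ s, w j • v j =
      (η / (2 * (1 + η * ∑ j ∈ s, a j))) • ∑ j ∈ s, a j • v j := by
    rw [smul_sum]
    refine sum_congr rfl fun j hj => ?_
    rw [hw j hj, smul_smul, mul_div_right_comm]
  have hsplit : ∑ j ∈ s, a j • (v i + v j) = (∑ j ∈ s, a j) • v i + ∑ j ∈ s, a j • v j := by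
    simp only [smul_add, sum_add_distrib, sum_smul]
  rw [sum_insert hi, hsum, hwi, hsplit]
  generalize ∑ j ∈ s, a j = S at hpos ⊢
  match_scalars <;> field_simp

/-- Lemma: reformulation of the ECL.
With `θ = 1/2`, `z_{i|j}^{(0)} = A_{i|j} x_j^{(0)}` and symmetric nonnegative `α`,
the ECL updates and the reformulated updates (weighted average plus corrected
stochastic gradient step) generate the same sequences `(x_i^{(r)})` from the same
initialization. Here `A_{i|j}` is `+1` if `i > j` and `-1` if `i < j`, `N i` is the
neighborhood of `i`, `W` and `η′_i` are defined from `η` and `α` as in the paper. -/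
theorem ecl_reformulation
    (n d : ℕ)
    (Adj : Fin n → Fin n → Prop) [DecidableRel Adj]
    (hAdj_symm : ∀ i j, Adj i j → Adj j i)
    (hAdj_irrefl : ∀ i, ¬ Adj i i)
    (η : ℝ) (hη : 0 < η)
    (α : Fin n → Fin n → ℝ)
    (hα_nonneg : ∀ i j, Adj i j → 0 ≤ α i j)
    (hα_symm : ∀ i j, Adj i j → α i j = α j i)
    -- the maps A_{i|j} = ±I, encoded by their scalar sign
    (A : Fin n → Fin n → ℝ)
    (hA : ∀ i j : Fin n, A i j = if j < i then (1 : ℝ) else -1)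
    -- arbitrary realized stochastic gradients
    (g : ℕ → Fin n → EuclideanSpace ℝ (Fin d))
    -- the ECL sequences
    (x : ℕ → Fin n → EuclideanSpace ℝ (Fin d))
    (y z : ℕ → Fin n → Fin n → EuclideanSpace ℝ (Fin d))
    (hz0 : ∀ i j, Adj i j → z 0 i j = A i j • x 0 j)
    (hx : ∀ r i, x (r+1) i =
      (1 + η * ∑ j ∈ univ.filter (fun j => Adj i j), α i j)⁻¹ •
        (x r i - η • g r i
          + η • ∑ j ∈ univ.filter (fun j => Adj i j), (α i j * A i j) • z r i j))
    (hy : ∀ r i j, Adj i j → y (r+1) i j = z r i j - (2 * A i j) • x (r+1) i)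
    (hz : ∀ r i j, Adj i j →
      z (r+1) i j = (1/2 : ℝ) • z r i j + (1/2 : ℝ) • y (r+1) j i)
    -- the weights W and step sizes η′_i of the reformulation
    (W : Fin n → Fin n → ℝ)
    (hW : ∀ i j, W i j =
      if i = j then
        (2 + η * ∑ k ∈ univ.filter (fun k => Adj i k), α i k) /
          (2 * (1 + η * ∑ k ∈ univ.filter (fun k => Adj i k), α i k))
      else if Adj i j then
        η * α i j / (2 * (1 + η * ∑ k ∈ univ.filter (fun k => Adj i k), α i k))
      else 0)
    (η' : Fin n → ℝ)
    (hη' : ∀ i, η' i = η / (1 + η * ∑ j ∈ univ.filter (fun j => Adj i j), α i j))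
    -- the reformulated sequences, started from the same initialization
    (x' : ℕ → Fin n → EuclideanSpace ℝ (Fin d))
    (c : ℕ → Fin n → EuclideanSpace ℝ (Fin d))
    (hx'0 : ∀ i, x' 0 i = x 0 i)
    (hc0 : ∀ i, c 0 i =
      (1/2 : ℝ) • ∑ j ∈ univ.filter (fun j => Adj i j), α i j • (x' 0 j - x' 0 i))
    (hx' : ∀ r i, x' (r+1) i =
      (∑ j ∈ insert i (univ.filter (fun j => Adj i j)), W i j • x' r j)
        - η' i • (g r i - c r i))
    (hc : ∀ r i, c (r+1) i = c r i +
      (1/2 : ℝ) • ∑ j ∈ univ.filter (fun j => Adj i j), α i j • (x' (r+1) j - x' (r+1) i)) :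
    ∀ r i, x' r i = x r i := by
  have hne : ∀ {i j}, Adj i j → i ≠ j := fun h e => hAdj_irrefl _ (e ▸ h)
  have hA_anti : ∀ {i j}, Adj i j → A j i = -A i j := by
    intro i j h
    rcases lt_or_gt_of_ne (hne h) with hlt | hlt <;> simp [hA, hlt, hlt.not_gt]
  have hA_sq : ∀ i j, A i j * A i j = 1 := by
    intro i j
    rw [hA]
    split_ifs <;> norm_num
  have hz_succ : ∀ r i j, Adj i j →
      z (r + 1) i j = (1 / 2 : ℝ) • (z r i j + z r j i) + A i j • x (r + 1) j := by
    intro r i j h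
    rw [hz r i j h, hy r j i (hAdj_symm i j h), hA_anti h]
    module
  have hz_diff : ∀ r i j, Adj i j → z r i j - z r j i = A i j • (x r i + x r j) := by
    rintro (_ | r) i j h
    · rw [hz0 i j h, hz0 j i (hAdj_symm i j h), hA_anti h]
      module
    · rw [hz_succ r i j h, hz_succ r j i (hAdj_symm i j h), hA_anti h]
      module
  have hAz : ∀ r i j, Adj i j → (α i j * A i j) • z r i j =
      (1 / 2 : ℝ) • (α i j • A i j • (z r i j + z r j i)) +
        (1 / 2 : ℝ) • (α i j • (x r i + x r j)) := by
    intro r i j h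
    have hx_add : x r i + x r j = A i j • (z r i j - z r j i) := by
      rw [hz_diff r i j h, smul_smul, hA_sq, one_smul]
    rw [hx_add]
    module
  have hAz_succ : ∀ r i j, Adj i j → A i j • (z (r + 1) i j + z (r + 1) j i) =
      A i j • (z r i j + z r j i) + (x (r + 1) j - x (r + 1) i) := by
    intro r i j h
    have hx_sub : x (r + 1) j - x (r + 1) i =
        (A i j * A i j) • (x (r + 1) j - x (r + 1) i) := by
      rw [hA_sq, one_smul]
    rw [hx_sub, hz_succ r i j h, hz_succ r j i (hAdj_symm i j h), hA_anti h]
    module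
  have hpos : ∀ i, 0 < 1 + η * ∑ j ∈ univ.filter (fun j => Adj i j), α i j := by
    intro i
    have hS : 0 ≤ ∑ j ∈ univ.filter (fun j => Adj i j), α i j :=
      sum_nonneg fun j hj => hα_nonneg i j (mem_filter.1 hj).2
    positivity
  have key : ∀ r, (∀ i, x' r i = x r i) ∧ ∀ i, c r i =
      (1 / 2 : ℝ) • ∑ j ∈ univ.filter (fun j => Adj i j),
        α i j • A i j • (z r i j + z r j i) := by
    intro r
    induction r with
    | zero =>
      refine ⟨hx'0, fun i => ?_⟩
      rw [hc0]
      congr 1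
      refine sum_congr rfl fun j hj => ?_
      have h : Adj i j := (mem_filter.1 hj).2
      rw [hz0 i j h, hz0 j i (hAdj_symm i j h), hA_anti h, hx'0, hx'0, neg_smul,
        ← sub_eq_add_neg, ← smul_sub, smul_smul (A i j), hA_sq, one_smul]
    | succ r ih =>
      obtain ⟨ihx, ihc⟩ := ih
      have hx_eq : ∀ i, x' (r + 1) i = x (r + 1) i := by
        intro i
        have hz_sum : ∑ j ∈ univ.filter (fun j => Adj i j), (α i j * A i j) • z r i j =
            c r i + (1 / 2 : ℝ) •
              ∑ j ∈ univ.filter (fun j => Adj i j), α i j • (x r i + x r j) := by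
          rw [ihc, smul_sum, smul_sum, ← sum_add_distrib]
          exact sum_congr rfl fun j hj => hAz r i j (mem_filter.1 hj).2
        rw [hx', hx, hz_sum, hη', sum_insert_mixing_weights (a := α i) (by simp [hAdj_irrefl i])
          (hpos i) (by rw [hW, if_pos rfl])]
        · simp only [ihx]
          module
        · intro j hj
          have h : Adj i j := (mem_filter.1 hj).2
          rw [hW, if_neg (hne h), if_pos h]
      refine ⟨hx_eq, fun i => ?_⟩
      rw [hc, ihc, ← smul_add, ← sum_add_distrib]
      congr 1
      refine sum_congr rfl fun j hj => ?_
      rw [hAz_succ r i j (mem_filter.1 hj).2, hx_eq, hx_eq, ← smul_add (α i j)]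
  exact fun r => (key r).1
end

section
/- Suppose θ = 1/2, z_{i|j}^{(0)} = A_{i|j} x_j^{(0)}, α_{i|j} = α_{j|i} ≥ 0 for all edges, and additionally there exists α > 0 with Σ_{k∈N_i} α_{i|k} = α for every node i. Then for every choice of the vectors g_i^{(r)} ∈ ℝ^d, the ECL updates x_i^{(r+1)} = (1 + η Σ_{j∈N_i} α_{i|j})^{-1} (x_i^{(r)} − η g_i^{(r)} + η Σ_{j∈N_i} α_{i|j} A_{i|j} z_{i|j}^{(r)}), y_{i|j}^{(r+1)} = z_{i|j}^{(r)} − 2 A_{i|j} x_i^{(r+1)}, z_{i|j}^{(r+1)} = (1/2) z_{i|j}^{(r)} + (1/2) y_{j|i}^{(r+1)} produce the same sequences (x_i^{(r)}) as the G-ECL updates: x̃_i^{(r)} = Σ_{j∈N_i⁺} W_{ij} x_j^{(r)}; x_i^{(r+1)} = x̃_i^{(r)} − η′ (g_i^{(r)} − c_i^{(r)}); c_i^{(r+1)} = Σ_{j∈N_i⁺} W_{ij} (c_j^{(r)} − g_j^{(r)}) + g_i^{(r)} + Σ_{j∈N_i} (α_{i|j}/2)(x̃_j^{(r)} − x̃_i^{(r)}),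 with η′ = η/(1 + ηα) and c_i^{(0)} = (1/2) Σ_{j∈N_i} α_{i|j} (x_j^{(0)} − x_i^{(0)}). -/
open Finset

/-- The weighted graph Laplacian `v ↦ (i ↦ ∑ j ∈ s i, w i j • (v j - v i))` with neighbor sets `s`
and edge weights `w`, up to sign. -/
def weightedDiffSum {ι E : Type*} [AddCommGroup E] [Module ℝ E] (s : ι → Finset ι)
    (w : ι → ι → ℝ) (v : ι → E) (i : ι) : E :=
  ∑ j ∈ s i, w i j • (v j - v i)

section

variable {ι E : Type*} [AddCommGroup E] [Module ℝ E] (s : ι → Finset ι) (w : ι → ι → ℝ)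

theorem weightedDiffSum_sub_smul_sub (u v v' : ι → E) (a : ℝ) (i : ι) :
    weightedDiffSum s w (fun j => u j - a • (v j - v' j)) i =
      weightedDiffSum s w u i + a • weightedDiffSum s w (fun j => v' j - v j) i := by
  simp only [weightedDiffSum, Finset.smul_sum, ← Finset.sum_add_distrib]
  refine Finset.sum_congr rfl fun j _ => ?_
  module

theorem weightedDiffSum_eq_sub {a : ℝ} {i : ι} (h : ∑ j ∈ s i, w i j = a) (v : ι → E) :
    weightedDiffSum s w v i = ∑ j ∈ s i, w i j • v j - a • v i := by
  simp only [weightedDiffSum, smul_sub, Finset.sum_sub_distrib, ← Finset.sum_smul, h]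

theorem sum_insert_mixing_smul [DecidableEq ι] {η a : ℝ} {i : ι} (hi : i ∉ s i)
    (ha : 1 + η * a ≠ 0) (h : ∑ j ∈ s i, w i j = a) (W : ι → ℝ)
    (hWi : W i = (2 + η * a) / (2 * (1 + η * a)))
    (hW : ∀ j ∈ s i, W j = η * w i j / (2 * (1 + η * a))) (v : ι → E) :
    ∑ j ∈ insert i (s i), W j • v j =
      v i + (η / (1 + η * a) / 2) • weightedDiffSum s w v i := by
  have hsum : ∑ j ∈ s i, W j • v j = (η / (1 + η * a) / 2) • ∑ j ∈ s i, w i j • v j := by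
    rw [Finset.smul_sum]
    refine Finset.sum_congr rfl fun j hj => ?_
    rw [hW j hj, smul_smul]
    congr 1
    field_simp
  rw [Finset.sum_insert hi, hsum, hWi, weightedDiffSum_eq_sub s w h]
  match_scalars <;> field_simp
  ring

end

/-- ECL = G-ECL under the regularity assumption.
With `θ = 1/2`, `z_{i|j}^{(0)} = A_{i|j} x_j^{(0)}`, symmetric nonnegative `α`, and
`Σ_{k∈N_i} α_{i|k} = α` for every `i`, the ECL updates generate the same sequences
`(x_i^{(r)})` as the G-ECL updates with `η′ = η/(1+ηα)` and the mixing weights `W`. -/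
theorem ecl_eq_gecl
    (n d : ℕ)
    (Adj : Fin n → Fin n → Prop) [DecidableRel Adj]
    (hAdj_symm : ∀ i j, Adj i j → Adj j i)
    (hAdj_irrefl : ∀ i, ¬ Adj i i)
    (η : ℝ) (hη : 0 < η)
    (α : Fin n → Fin n → ℝ)
    (hα_nonneg : ∀ i j, Adj i j → 0 ≤ α i j)
    (hα_symm : ∀ i j, Adj i j → α i j = α j i)
    (αbar : ℝ) (hαbar : 0 < αbar)
    (hα_reg : ∀ i, ∑ k ∈ univ.filter (fun k => Adj i k), α i k = αbar)
    -- the maps A_{i|j} = ±I, encoded by their scalar sign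
    (A : Fin n → Fin n → ℝ)
    (hA : ∀ i j : Fin n, A i j = if j < i then (1 : ℝ) else -1)
    -- arbitrary realized stochastic gradients
    (g : ℕ → Fin n → EuclideanSpace ℝ (Fin d))
    -- the ECL sequences
    (x : ℕ → Fin n → EuclideanSpace ℝ (Fin d))
    (y z : ℕ → Fin n → Fin n → EuclideanSpace ℝ (Fin d))
    (hz0 : ∀ i j, Adj i j → z 0 i j = A i j • x 0 j)
    (hx : ∀ r i, x (r+1) i =
      (1 + η * ∑ j ∈ univ.filter (fun j => Adj i j), α i j)⁻¹ •
        (x r i - η • g r i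
          + η • ∑ j ∈ univ.filter (fun j => Adj i j), (α i j * A i j) • z r i j))
    (hy : ∀ r i j, Adj i j → y (r+1) i j = z r i j - (2 * A i j) • x (r+1) i)
    (hz : ∀ r i j, Adj i j →
      z (r+1) i j = (1/2 : ℝ) • z r i j + (1/2 : ℝ) • y (r+1) j i)
    -- the mixing weights W and the common step size η′
    (W : Fin n → Fin n → ℝ)
    (hW : ∀ i j, W i j =
      if i = j then
        (2 + η * ∑ k ∈ univ.filter (fun k => Adj i k), α i k) /
          (2 * (1 + η * ∑ k ∈ univ.filter (fun k => Adj i k), α i k))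
      else if Adj i j then
        η * α i j / (2 * (1 + η * ∑ k ∈ univ.filter (fun k => Adj i k), α i k))
      else 0)
    (η' : ℝ) (hη' : η' = η / (1 + η * αbar))
    -- the G-ECL sequences, started from the same initialization
    (x' xt : ℕ → Fin n → EuclideanSpace ℝ (Fin d))
    (c : ℕ → Fin n → EuclideanSpace ℝ (Fin d))
    (hx'0 : ∀ i, x' 0 i = x 0 i)
    (hc0 : ∀ i, c 0 i =
      (1/2 : ℝ) • ∑ j ∈ univ.filter (fun j => Adj i j), α i j • (x' 0 j - x' 0 i))
    (hxt : ∀ r i, xt r i = ∑ j ∈ insert i (univ.filter (fun j => Adj i j)), W i j • x' r j)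
    (hx' : ∀ r i, x' (r+1) i = xt r i - η' • (g r i - c r i))
    (hc : ∀ r i, c (r+1) i =
      (∑ j ∈ insert i (univ.filter (fun j => Adj i j)), W i j • (c r j - g r j))
        + g r i
        + ∑ j ∈ univ.filter (fun j => Adj i j), (α i j / 2) • (xt r j - xt r i)) :
    ∀ r i, x' r i = x r i := by
  classical
  set N : Fin n → Finset (Fin n) := fun i => univ.filter (fun j => Adj i j) with hN
  have hmem : ∀ {i j}, j ∈ N i ↔ Adj i j := by simp [hN]
  have hpos : 1 + η * αbar ≠ 0 := by positivity
  have hne : ∀ {i j}, Adj i j → i ≠ j := fun {i j} h hij => hAdj_irrefl j (hij ▸ h)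
  have hA_anti : ∀ i j, Adj i j → A j i = -A i j := by
    intro i j h
    rcases lt_or_gt_of_ne (hne h) with h' | h' <;> simp [hA, h', h'.not_gt]
  have hA_sq : ∀ i j, A i j * A i j = 1 := by
    intro i j
    rw [hA]
    split_ifs <;> norm_num
  have hmix : ∀ i (v : Fin n → EuclideanSpace ℝ (Fin d)),
      ∑ j ∈ insert i (N i), W i j • v j = v i + (η' / 2) • weightedDiffSum N α v i := by
    intro i v
    rw [hη']
    refine sum_insert_mixing_smul N α (by simp [hmem, hAdj_irrefl]) hpos (hα_reg i) (W i) ?_ ?_ v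
    · rw [hW, if_pos rfl, hα_reg]
    · intro j hj
      rw [hW, if_neg (hne (hmem.1 hj)), if_pos (hmem.1 hj), hα_reg]
  have hz_succ : ∀ r i j, Adj i j →
      z (r+1) i j = (1/2 : ℝ) • (z r i j + z r j i) + A i j • x (r+1) j := by
    intro r i j h
    rw [hz r i j h, hy r j i (hAdj_symm i j h), hA_anti i j h]
    module
  have hz_sum : ∀ r i j, Adj i j → A i j • (z (r+1) i j + z (r+1) j i) =
      A i j • (z r i j + z r j i) + (x (r+1) j - x (r+1) i) := by
    intro r i j h
    rw [hz_succ r i j h, hz_succ r j i (hAdj_symm i j h), hA_anti i j h]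
    linear_combination (norm := module) (hA_sq i j) • (x (r+1) j - x (r+1) i)
  have hz_diff : ∀ r i j, Adj i j → A i j • (z r i j - z r j i) = x r i + x r j := by
    intro r i j h
    cases r with
    | zero =>
      rw [hz0 i j h, hz0 j i (hAdj_symm i j h), hA_anti i j h]
      linear_combination (norm := module) (hA_sq i j) • (x 0 i + x 0 j)
    | succ r =>
      rw [hz_succ r i j h, hz_succ r j i (hAdj_symm i j h), hA_anti i j h]
      linear_combination (norm := module) (hA_sq i j) • (x (r+1) i + x (r+1) j)
  have hx_succ : ∀ r i, x (r+1) i = x r i + (η' / 2) • weightedDiffSum N α (x r) i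
      - η' • (g r i - (1/2 : ℝ) • ∑ j ∈ N i, α i j • A i j • (z r i j + z r j i)) := by
    intro r i
    have hsum : ∑ j ∈ N i, (α i j * A i j) • z r i j =
        (1/2 : ℝ) • ∑ j ∈ N i, α i j • A i j • (z r i j + z r j i)
          + (1/2 : ℝ) • weightedDiffSum N α (x r) i + αbar • x r i := by
      rw [← hα_reg i, weightedDiffSum, Finset.sum_smul, Finset.smul_sum, Finset.smul_sum,
        ← Finset.sum_add_distrib, ← Finset.sum_add_distrib]
      refine Finset.sum_congr rfl fun j hj => ?_
      linear_combination (norm := module) (α i j / 2) • hz_diff r i j (hmem.1 hj)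
    rw [hx, hα_reg, hsum, hη']
    match_scalars <;> field_simp
  have key : ∀ r, (∀ i, x' r i = x r i) ∧
      ∀ i, c r i = (1/2 : ℝ) • ∑ j ∈ N i, α i j • A i j • (z r i j + z r j i) := by
    intro r
    induction r with
    | zero =>
      refine ⟨hx'0, fun i => ?_⟩
      rw [hc0]
      congr 1
      refine Finset.sum_congr rfl fun j hj => ?_
      have h := hmem.1 hj
      rw [hz0 i j h, hz0 j i (hAdj_symm i j h), hA_anti i j h, hx'0, hx'0]
      congr 1
      linear_combination (norm := module) (-1 : ℝ) • (hA_sq i j) • (x 0 j - x 0 i)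
    | succ r ih =>
      obtain ⟨ihx, ihc⟩ := ih
      have hxr : x' r = x r := funext ihx
      have hx_new : ∀ i, x' (r+1) i = x (r+1) i := by
        intro i
        rw [hx', hxt, hmix, hx_succ, ← ihc, hxr]
      refine ⟨hx_new, fun i => ?_⟩
      have hstep : (1/2 : ℝ) • ∑ j ∈ N i, α i j • A i j • (z (r+1) i j + z (r+1) j i) =
          c r i + (1/2 : ℝ) • weightedDiffSum N α (x (r+1)) i := by
        rw [ihc, weightedDiffSum, ← smul_add, ← Finset.sum_add_distrib]
        congr 1
        refine Finset.sum_congr rfl fun j hj => ?_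
        rw [hz_sum r i j (hmem.1 hj), smul_add]
      have hlap : weightedDiffSum N α (x (r+1)) i = weightedDiffSum N α (xt r) i
          + η' • weightedDiffSum N α (fun j => c r j - g r j) i := by
        rw [← weightedDiffSum_sub_smul_sub]
        congr 1
        funext j
        rw [← hx_new, hx']
      have hhalf : ∑ j ∈ N i, (α i j / 2) • (xt r j - xt r i) =
          (1/2 : ℝ) • weightedDiffSum N α (xt r) i := by
        rw [weightedDiffSum, Finset.smul_sum]
        refine Finset.sum_congr rfl fun j _ => ?_
        module
      rw [hstep, hlap, hc, hmix i (fun j => c r j - g r j), hhalf]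
      module
  exact fun r => (key r).1
end

section
/- Suppose α_{i|j} = α_{j|i} ≥ 0 for all edges (i,j) ∈ E and there exists α > 0 with Σ_{k∈N_i} α_{i|k} = α for every node i. Then the matrix W ∈ ℝ^{n×n} defined by W_{ii} = (2 + η Σ_{k∈N_i} α_{i|k})/(2(1 + η Σ_{k∈N_i} α_{i|k})), W_{ij} = η α_{i|j}/(2(1 + η Σ_{k∈N_i} α_{i|k})) for (i,j) ∈ E, and W_{ij} = 0 otherwise, is a mixing matrix: all its entries lie in [0,1], W is symmetric (W = Wᵀ), and W is doubly stochastic (W𝟙 = 𝟙 and 𝟙ᵀW = 𝟙ᵀ). -/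
open Finset

/-- If `α_{i|j} = α_{j|i} ≥ 0` on edges and all neighbor-sums
`Σ_{k∈N_i} α_{i|k}` equal a common `α > 0`, then the matrix `W` defined from
the ECL hyperparameters is a mixing matrix: entries in `[0,1]`, symmetric,
and doubly stochastic. -/
theorem ecl_W_is_mixing_matrix
    (n : ℕ) (hn : 0 < n)
    (Adj : Fin n → Fin n → Prop) [DecidableRel Adj]
    (hAdj_symm : ∀ i j, Adj i j → Adj j i)
    (hAdj_irrefl : ∀ i, ¬ Adj i i)
    (η : ℝ) (hη : 0 < η)
    (α : Fin n → Fin n → ℝ)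
    (hα_nonneg : ∀ i j, Adj i j → 0 ≤ α i j)
    (hα_symm : ∀ i j, Adj i j → α i j = α j i)
    (αbar : ℝ) (hαbar : 0 < αbar)
    (hα_reg : ∀ i, ∑ k ∈ univ.filter (fun k => Adj i k), α i k = αbar)
    (W : Fin n → Fin n → ℝ)
    (hW : ∀ i j, W i j =
      if i = j then
        (2 + η * ∑ k ∈ univ.filter (fun k => Adj i k), α i k) /
          (2 * (1 + η * ∑ k ∈ univ.filter (fun k => Adj i k), α i k))
      else if Adj i j then
        η * α i j / (2 * (1 + η * ∑ k ∈ univ.filter (fun k => Adj i k), α i k))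
      else 0) :
    (∀ i j, 0 ≤ W i j ∧ W i j ≤ 1) ∧
    (∀ i j, W i j = W j i) ∧
    (∀ i, ∑ j, W i j = 1) ∧
    (∀ j, ∑ i, W i j = 1) := by
  have hden : 0 < 2 * (1 + η * αbar) := by positivity
  have hW' : ∀ i j, W i j =
      (if i = j then (2 + η * αbar) / (2 * (1 + η * αbar)) else 0) +
        (if Adj i j then η * α i j / (2 * (1 + η * αbar)) else 0) := by
    intro i j
    rw [hW, hα_reg]
    by_cases h : i = j
    · subst h
      simp [hAdj_irrefl]
    · simp [h]
  have hnonneg : ∀ i j, 0 ≤ W i j := by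
    intro i j
    rw [hW']
    refine add_nonneg ?_ ?_
    · split_ifs <;> positivity
    · split_ifs with h
      · have := hα_nonneg i j h
        positivity
      · exact le_rfl
  have hsymm : ∀ i j, W i j = W j i := by
    intro i j
    rw [hW', hW' j i]
    congr 1
    · simp only [eq_comm]
    · by_cases h : Adj i j
      · rw [if_pos h, if_pos (hAdj_symm i j h), hα_symm i j h]
      · rw [if_neg h, if_neg (fun h' => h (hAdj_symm j i h'))]
  have hrow : ∀ i, ∑ j, W i j = 1 := by
    intro i
    simp only [hW', sum_add_distrib, sum_ite_eq, mem_univ, if_true]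
    rw [← sum_filter, ← sum_div, ← mul_sum, hα_reg]
    field_simp
    ring
  refine ⟨fun i j => ⟨hnonneg i j, ?_⟩, hsymm, hrow, fun j => ?_⟩
  · rw [← hrow i]
    exact single_le_sum (fun k _ => hnonneg i k) (mem_univ j)
  · rw [← hrow j]
    exact sum_congr rfl fun i _ => hsymm i j
end

section
/- Suppose α_{i|j} = α_{j|i} ≥ 0 for all edges and there exists α > 0 with Σ_{k∈N_i} α_{i|k} = α for every node i, so that W is a mixing matrix and η′ = η/(1 + ηα). Let (x_i^{(r)}), (c_i^{(r)}) be generated, from arbitrary initial x_i^{(0)} and c_i^{(0)} = (1/2) Σ_{j∈N_i} α_{i|j}(x_j^{(0)} − x_i^{(0)}), by x̃_i^{(r)} = Σ_{j∈N_i⁺} W_{ij} x_j^{(r)}, x_i^{(r+1)} = x̃_i^{(r)} − η′(g_i^{(r)} − c_i^{(r)}), c_i^{(r+1)} = Σ_{j∈N_i⁺} W_{ij}(c_j^{(r)} − g_j^{(r)}) + g_i^{(r)} + Σ_{j∈N_i}(α_{i|j}/2)(x̃_j^{(r)} − x̃_i^{(r)}). Then the average x̄^{(r)} = (1/n) Σ_{i=1}^{n}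 x_i^{(r)} satisfies x̄^{(r+1)} = x̄^{(r)} − (η′/n) Σ_{i=1}^{n} g_i^{(r)} for every round r ≥ 0. -/
open Finset

/-- A sum of differences over ordered neighbor pairs with symmetric weights vanishes. -/
theorem sum_neighbor_smul_sub_eq_zero {ι R E : Type*} [Fintype ι] [Ring R]
    [AddCommGroup E] [Module R E] {Adj : ι → ι → Prop} [DecidableRel Adj]
    (hAdj : ∀ i j, Adj i j → Adj j i) {β : ι → ι → R}
    (hβ : ∀ i j, Adj i j → β i j = β j i) (v : ι → E) :
    ∑ i, ∑ j ∈ univ.filter (fun j => Adj i j), β i j • (v j - v i) = 0 := by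
  simp only [smul_sub, sum_sub_distrib, sub_eq_zero, sum_filter]
  rw [sum_comm]
  refine sum_congr rfl fun i _ => sum_congr rfl fun j _ => ?_
  by_cases h : Adj i j
  · rw [if_pos h, if_pos (hAdj i j h), hβ i j h]
  · rw [if_neg h, if_neg (mt (hAdj j i) h)]

/-- Mixing with symmetric weights whose rows sum to one preserves the total. -/
theorem sum_mixing_eq_sum {ι R E : Type*} [Fintype ι] [DecidableEq ι] [Ring R]
    [AddCommGroup E] [Module R E] {Adj : ι → ι → Prop} [DecidableRel Adj]
    (hAdj : ∀ i j, Adj i j → Adj j i) (hirrefl : ∀ i, ¬ Adj i i) {W : ι → ι → R}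
    (hW : ∀ i j, Adj i j → W i j = W j i)
    (hrow : ∀ i, W i i + ∑ j ∈ univ.filter (fun j => Adj i j), W i j = 1) (v : ι → E) :
    ∑ i, ∑ j ∈ insert i (univ.filter (fun j => Adj i j)), W i j • v j = ∑ i, v i := by
  have split (i : ι) : ∑ j ∈ insert i (univ.filter (fun j => Adj i j)), W i j • v j =
      v i + ∑ j ∈ univ.filter (fun j => Adj i j), W i j • (v j - v i) := by
    rw [sum_insert (by simp [hirrefl i])]
    simp only [smul_sub, sum_sub_distrib, ← sum_smul]
    rw [eq_sub_of_add_eq (hrow i), sub_smul, one_smul]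
    abel
  simp only [split, sum_add_distrib, sum_neighbor_smul_sub_eq_zero hAdj hW, add_zero]

/-- Average sequence of the G-ECL.
Under symmetric nonnegative `α` with common neighbor-sum `α > 0` (so that `W` is a
mixing matrix and `η′ = η/(1+ηα)`), the averages of the iterates generated by the
G-ECL updates satisfy `x̄^{(r+1)} = x̄^{(r)} − (η′/n) Σ_i g_i^{(r)}`. -/
theorem gecl_average_sequence
    (n d : ℕ)
    (Adj : Fin n → Fin n → Prop) [DecidableRel Adj]
    (hAdj_symm : ∀ i j, Adj i j → Adj j i)
    (hAdj_irrefl : ∀ i, ¬ Adj i i)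
    (η : ℝ) (hη : 0 < η)
    (α : Fin n → Fin n → ℝ)
    (hα_nonneg : ∀ i j, Adj i j → 0 ≤ α i j)
    (hα_symm : ∀ i j, Adj i j → α i j = α j i)
    (αbar : ℝ) (hαbar : 0 < αbar)
    (hα_reg : ∀ i, ∑ k ∈ univ.filter (fun k => Adj i k), α i k = αbar)
    (W : Fin n → Fin n → ℝ)
    (hW : ∀ i j, W i j =
      if i = j then
        (2 + η * ∑ k ∈ univ.filter (fun k => Adj i k), α i k) /
          (2 * (1 + η * ∑ k ∈ univ.filter (fun k => Adj i k), α i k))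
      else if Adj i j then
        η * α i j / (2 * (1 + η * ∑ k ∈ univ.filter (fun k => Adj i k), α i k))
      else 0)
    (η' : ℝ) (hη' : η' = η / (1 + η * αbar))
    -- arbitrary realized stochastic gradients
    (g : ℕ → Fin n → EuclideanSpace ℝ (Fin d))
    -- the G-ECL sequences, from arbitrary initial x^{(0)}
    (x xt : ℕ → Fin n → EuclideanSpace ℝ (Fin d))
    (c : ℕ → Fin n → EuclideanSpace ℝ (Fin d))
    (hc0 : ∀ i, c 0 i =
      (1/2 : ℝ) • ∑ j ∈ univ.filter (fun j => Adj i j), α i j • (x 0 j - x 0 i))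
    (hxt : ∀ r i, xt r i = ∑ j ∈ insert i (univ.filter (fun j => Adj i j)), W i j • x r j)
    (hx : ∀ r i, x (r+1) i = xt r i - η' • (g r i - c r i))
    (hc : ∀ r i, c (r+1) i =
      (∑ j ∈ insert i (univ.filter (fun j => Adj i j)), W i j • (c r j - g r j))
        + g r i
        + ∑ j ∈ univ.filter (fun j => Adj i j), (α i j / 2) • (xt r j - xt r i)) :
    ∀ r, (n : ℝ)⁻¹ • ∑ i, x (r+1) i =
      (n : ℝ)⁻¹ • ∑ i, x r i - (η' / n) • ∑ i, g r i := by
  simp only [hα_reg] at hW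
  have hpos : 0 < 1 + η * αbar := by positivity
  have hoff (i j : Fin n) (h : Adj i j) : W i j = η * α i j / (2 * (1 + η * αbar)) := by
    have hne : i ≠ j := fun e => hAdj_irrefl j (e ▸ h)
    rw [hW, if_neg hne, if_pos h]
  have hW_symm (i j : Fin n) (h : Adj i j) : W i j = W j i := by
    rw [hoff i j h, hoff j i (hAdj_symm i j h), hα_symm i j h]
  have hW_row (i : Fin n) : W i i + ∑ j ∈ univ.filter (fun j => Adj i j), W i j = 1 := by
    rw [sum_congr rfl fun j hj => hoff i j (mem_filter.mp hj).2, ← sum_div, ← mul_sum,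
      hα_reg, hW, if_pos rfl]
    field_simp
    ring
  have hmix := sum_mixing_eq_sum (E := EuclideanSpace ℝ (Fin d)) hAdj_symm hAdj_irrefl
    hW_symm hW_row
  have hα_half (i j : Fin n) (h : Adj i j) : α i j / 2 = α j i / 2 := by
    rw [hα_symm i j h]
  have hc_sum (r : ℕ) : ∑ i, c r i = 0 := by
    induction r with
    | zero =>
      simp only [hc0, ← smul_sum]
      rw [sum_neighbor_smul_sub_eq_zero hAdj_symm hα_symm, smul_zero]
    | succ r ih =>
      simp only [hc, sum_add_distrib]
      rw [hmix fun j => c r j - g r j,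
        sum_neighbor_smul_sub_eq_zero hAdj_symm hα_half, sum_sub_distrib, ih]
      abel
  intro r
  simp only [hx, hxt, sum_sub_distrib, ← smul_sum]
  rw [hmix, hc_sum, sub_zero, smul_sub, smul_smul, div_eq_inv_mul]
end

section
/- Suppose θ = 1/2, z_{i|j}^{(0)} = A_{i|j} x_j^{(0)}, α_{i|j} = α_{j|i} ≥ 0 for all edges, and there exists α > 0 with Σ_{k∈N_i} α_{i|k} = α for every node i. Then for every choice of the vectors g_i^{(r)} ∈ ℝ^d, the ECL updates x_i^{(r+1)} = (1 + η Σ_{j∈N_i} α_{i|j})^{-1}(x_i^{(r)} − η g_i^{(r)} + η Σ_{j∈N_i} α_{i|j} A_{i|j} z_{i|j}^{(r)}), y_{i|j}^{(r+1)} = z_{i|j}^{(r)} − 2 A_{i|j} x_i^{(r+1)}, z_{i|j}^{(r+1)} = (1/2) z_{i|j}^{(r)} + (1/2) y_{j|i}^{(r+1)} produce the same sequences (x_i^{(r)}) as the gradient-tracking-type updates: x̃_i^{(r)} = Σ_{j∈N_i⁺} W_{ij} x_j^{(r)}; x_i^{(r+1)} = x̃_i^{(r)} − η′ p_i^{(r)};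 p_i^{(r+1)} = Σ_{j∈N_i⁺} W_{ij} p_j^{(r)} + (g_i^{(r+1)} − g_i^{(r)}) − Σ_{j∈N_i}(α_{i|j}/2)(x̃_j^{(r)} − x̃_i^{(r)}), with η′ = η/(1+ηα) and p_i^{(0)} = g_i^{(0)} − (1/2) Σ_{j∈N_i} α_{i|j}(x_j^{(0)} − x_i^{(0)}). -/
open Finset

/-- ECL = gradient-tracking-type updates.
With `θ = 1/2`, `z_{i|j}^{(0)} = A_{i|j} x_j^{(0)}`, symmetric nonnegative `α`, and
`Σ_{k∈N_i} α_{i|k} = α` for every `i`, the ECL updates generate the same sequences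
`(x_i^{(r)})` as the gradient-tracking-type updates with tracking variables `p_i^{(r)}`,
`η′ = η/(1+ηα)`, and the mixing weights `W`. -/
theorem ecl_eq_gradient_tracking_form
    (n d : ℕ)
    (Adj : Fin n → Fin n → Prop) [DecidableRel Adj]
    (hAdj_symm : ∀ i j, Adj i j → Adj j i)
    (hAdj_irrefl : ∀ i, ¬ Adj i i)
    (η : ℝ) (hη : 0 < η)
    (α : Fin n → Fin n → ℝ)
    (hα_nonneg : ∀ i j, Adj i j → 0 ≤ α i j)
    (hα_symm : ∀ i j, Adj i j → α i j = α j i)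
    (αbar : ℝ) (hαbar : 0 < αbar)
    (hα_reg : ∀ i, ∑ k ∈ univ.filter (fun k => Adj i k), α i k = αbar)
    -- the maps A_{i|j} = ±I, encoded by their scalar sign
    (A : Fin n → Fin n → ℝ)
    (hA : ∀ i j : Fin n, A i j = if j < i then (1 : ℝ) else -1)
    -- arbitrary realized stochastic gradients
    (g : ℕ → Fin n → EuclideanSpace ℝ (Fin d))
    -- the ECL sequences
    (x : ℕ → Fin n → EuclideanSpace ℝ (Fin d))
    (y z : ℕ → Fin n → Fin n → EuclideanSpace ℝ (Fin d))
    (hz0 : ∀ i j, Adj i j → z 0 i j = A i j • x 0 j)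
    (hx : ∀ r i, x (r+1) i =
      (1 + η * ∑ j ∈ univ.filter (fun j => Adj i j), α i j)⁻¹ •
        (x r i - η • g r i
          + η • ∑ j ∈ univ.filter (fun j => Adj i j), (α i j * A i j) • z r i j))
    (hy : ∀ r i j, Adj i j → y (r+1) i j = z r i j - (2 * A i j) • x (r+1) i)
    (hz : ∀ r i j, Adj i j →
      z (r+1) i j = (1/2 : ℝ) • z r i j + (1/2 : ℝ) • y (r+1) j i)
    -- the mixing weights W and the common step size η′
    (W : Fin n → Fin n → ℝ)
    (hW : ∀ i j, W i j =
      if i = j then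
        (2 + η * ∑ k ∈ univ.filter (fun k => Adj i k), α i k) /
          (2 * (1 + η * ∑ k ∈ univ.filter (fun k => Adj i k), α i k))
      else if Adj i j then
        η * α i j / (2 * (1 + η * ∑ k ∈ univ.filter (fun k => Adj i k), α i k))
      else 0)
    (η' : ℝ) (hη' : η' = η / (1 + η * αbar))
    -- the G-ECL sequences, started from the same initialization
    (x' xt : ℕ → Fin n → EuclideanSpace ℝ (Fin d))
    (P : ℕ → Fin n → EuclideanSpace ℝ (Fin d))
    (hx'0 : ∀ i, x' 0 i = x 0 i)
    (hP0 : ∀ i, P 0 i = g 0 i -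
      (1/2 : ℝ) • ∑ j ∈ univ.filter (fun j => Adj i j), α i j • (x' 0 j - x' 0 i))
    (hxt : ∀ r i, xt r i = ∑ j ∈ insert i (univ.filter (fun j => Adj i j)), W i j • x' r j)
    (hx' : ∀ r i, x' (r+1) i = xt r i - η' • P r i)
    (hP : ∀ r i, P (r+1) i =
      (∑ j ∈ insert i (univ.filter (fun j => Adj i j)), W i j • P r j)
        + (g (r+1) i - g r i)
        - ∑ j ∈ univ.filter (fun j => Adj i j), (α i j / 2) • (xt r j - xt r i)) :
    ∀ r i, x' r i = x r i := by
  have hD : 0 < 1 + η * αbar := by positivity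
  set nb : Fin n → Finset (Fin n) := fun i => univ.filter (fun j => Adj i j) with hnb
  set M : (Fin n → EuclideanSpace ℝ (Fin d)) → Fin n → EuclideanSpace ℝ (Fin d) :=
    fun v i => ∑ j ∈ nb i, α i j • v j with hM
  set U : ℕ → Fin n → EuclideanSpace ℝ (Fin d) :=
    fun r i => ∑ j ∈ nb i, (α i j * A i j) • z r i j with hU
  have mem_nb : ∀ {i j}, j ∈ nb i → Adj i j := fun h => (mem_filter.mp h).2
  have hAA : ∀ i j, Adj i j → A i j * A j i = -1 := by
    intro i j h
    have hne : i ≠ j := fun e => hAdj_irrefl i (by rw [← e] at h; exact h)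
    rcases lt_or_gt_of_ne hne with h' | h' <;> simp [hA, h', not_lt.mpr h'.le]
  have hA2 : ∀ i j, A i j * A i j = 1 := by
    intro i j
    rw [hA]; split_ifs <;> norm_num
  have hα_sum : ∀ i (w : EuclideanSpace ℝ (Fin d)), ∑ j ∈ nb i, α i j • w = αbar • w := by
    intro i w
    rw [← sum_smul, hα_reg]
  have hWsum : ∀ (v : Fin n → EuclideanSpace ℝ (Fin d)) i, ∑ j ∈ insert i (nb i), W i j • v j =
      ((2 + η * αbar) / (2 * (1 + η * αbar))) • v i +
        (η / (2 * (1 + η * αbar))) • M v i := by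
    intro v i
    rw [sum_insert (fun h => hAdj_irrefl i (mem_nb h)), hW, if_pos rfl, hα_reg, hM, smul_sum]
    congr 1
    refine sum_congr rfl fun j hj => ?_
    have hij : i ≠ j := fun e => hAdj_irrefl i (by have := mem_nb hj; rwa [← e] at this)
    rw [hW, if_neg hij, if_pos (mem_nb hj), hα_reg, smul_smul]
    congr 1
    ring
  have hz' : ∀ r i j, Adj i j → A i j • z (r + 1) i j =
      (1 / 2 : ℝ) • A i j • z r i j + (1 / 2 : ℝ) • A i j • z r j i + x (r + 1) j := by
    intro r i j h
    rw [hz r i j h, hy r j i (hAdj_symm i j h)]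
    have := hAA i j h
    match_scalars
    · ring
    · ring
    · linear_combination (-1 : ℝ) * this
  have hflip : ∀ i j, Adj i j → A j i = -A i j := by
    intro i j h
    linear_combination (-A j i) * hA2 i j + A i j * hAA i j h
  have hzsum : ∀ r i j, Adj i j →
      A i j • z r i j - A i j • z r j i = x r i + x r j := by
    intro r i j h
    have hji := hAdj_symm i j h
    cases r with
    | zero =>
      rw [hz0 i j h, hz0 j i hji, smul_smul, smul_smul, hA2, hAA i j h]
      module
    | succ r =>
      have h1 := hz' r i j h
      have h2 := hz' r j i hji
      rw [hflip i j h] at h2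
      linear_combination (norm := module) h1 + h2
  have hUsucc : ∀ r i, U (r + 1) i =
      U r i - (αbar / 2) • x r i - (1 / 2 : ℝ) • M (x r) i + M (x (r + 1)) i := by
    intro r i
    have : (αbar / 2) • x r i = ∑ j ∈ nb i, α i j • ((1 / 2 : ℝ) • x r i) := by
      rw [hα_sum]; module
    rw [this]
    simp only [hU, hM]
    rw [smul_sum, ← sum_sub_distrib, ← sum_sub_distrib, ← sum_add_distrib]
    refine sum_congr rfl fun j hj => ?_
    have h1 := hz' r i j (mem_nb hj)
    have h2 := hzsum r i j (mem_nb hj)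
    rw [mul_smul, mul_smul]
    linear_combination (norm := module) α i j • h1 - (α i j / 2) • h2
  have key : ∀ r, (∀ i, x' r i = x r i) ∧
      ∀ i, P r i = g r i + (αbar / 2) • x r i + (1 / 2 : ℝ) • M (x r) i - U r i := by
    intro r
    induction r with
    | zero =>
      refine ⟨hx'0, fun i => ?_⟩
      have hU0 : U 0 i = M (x 0) i := by
        refine sum_congr rfl fun j hj => ?_
        rw [hz0 i j (mem_nb hj), smul_smul, mul_assoc, hA2, mul_one]
      rw [hP0, hU0]
      simp only [hx'0, smul_sub]
      rw [sum_sub_distrib, hα_sum]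
      change _ - (1 / 2 : ℝ) • (M (x 0) i - _) = _
      module
    | succ r ih =>
      obtain ⟨ihx, ihP⟩ := ih
      have ihx' : x' r = x r := funext ihx
      have hnext : ∀ i, x' (r + 1) i = x (r + 1) i := by
        intro i
        rw [hx', hxt, hWsum, hx, hα_reg, ihP, ihx', hη']
        change _ = _ • (_ + η • U r i)
        match_scalars <;> field_simp <;> ring
      refine ⟨hnext, fun i => ?_⟩
      have hMx : M (x (r + 1)) i = M (xt r) i - η' • M (P r) i := by
        simp only [hM]
        rw [smul_sum, ← sum_sub_distrib]
        refine sum_congr rfl fun j _ => ?_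
        rw [← hnext, hx']
        module
      have hLap : ∑ j ∈ nb i, (α i j / 2) • (xt r j - xt r i) =
          (1 / 2 : ℝ) • M (xt r) i - (αbar / 2) • xt r i := by
        have : (αbar / 2) • xt r i = ∑ j ∈ nb i, α i j • ((1 / 2 : ℝ) • xt r i) := by
          rw [hα_sum]; module
        rw [this]
        simp only [hM]
        rw [smul_sum, ← sum_sub_distrib]
        refine sum_congr rfl fun j _ => ?_
        module
      have hPi := ihP i
      have hUr : U r i = g r i + (αbar / 2) • x r i + (1 / 2 : ℝ) • M (x r) i - P r i := by
        rw [hPi]; abel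
      rw [hP, hWsum, hLap, hUsucc, hUr, hMx, ← hnext, hx', hη']
      match_scalars <;> field_simp <;> ring
  exact fun r => (key r).1
end
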